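/- Let H be a group of isometries of a metric space (Y,d). The quotient map Π : Y → 2^Y sending y to closure(H·y) is a topological quotient map onto its image equipped with the Hausdorff metric: a subset A of the image is closed if and only if Π⁻¹(A) is closed in Y. -/

import Mathlib

theorem setOf_orbit_apply {Y : Type*} [MetricSpace Y] (H : Subgroup (Y ≃ᵢ Y))
    {g : Y ≃ᵢ Y} (hg : g ∈ H) (x : Y) :
    {z : Y | ∃ h ∈ H, h (g x) = z} = {z : Y | ∃ h ∈ H, h x = z} := by
  ext z
  constructor
  · rintro ⟨h, hh, rfl⟩
    exact ⟨h * g, H.mul_mem hh hg, rfl⟩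
  · rintro ⟨h, hh, rfl⟩
    exact ⟨h * g⁻¹, H.mul_mem hh (H.inv_mem hg), congrArg h (g.symm_apply_apply x)⟩

theorem hausdorffEDist_closure_orbit_le {Y : Type*} [MetricSpace Y] (H : Subgroup (Y ≃ᵢ Y))
    (x y : Y) :
    Metric.hausdorffEDist (closure {z : Y | ∃ h ∈ H, h x = z})
      (closure {z : Y | ∃ h ∈ H, h y = z}) ≤ edist x y := by
  rw [Metric.hausdorffEDist_closure]
  refine Metric.hausdorffEDist_le_of_mem_edist ?_ ?_
  · rintro _ ⟨h, hh, rfl⟩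
    exact ⟨h y, ⟨h, hh, rfl⟩, (h.isometry.edist_eq x y).le⟩
  · rintro _ ⟨h, hh, rfl⟩
    exact ⟨h x, ⟨h, hh, rfl⟩, by rw [h.isometry.edist_eq, edist_comm]⟩


open EMetric in
/-- Let `H` be a group of isometries of a metric space `Y`, and let
`Π : Y → 2^Y` send `y` to the closure of its orbit.  Then `Π` is a quotient map onto
its image endowed with the Hausdorff metric: `Π` is continuous (indeed 1-Lipschitz
for the Hausdorff edistance), and a subset `A` of the image is closed (for the
Hausdorff metric) iff `Π⁻¹(A)` is closed in `Y`. -/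
theorem stmt5 {Y : Type*} [MetricSpace Y] (H : Subgroup (Y ≃ᵢ Y)) :
    (∀ x y : Y,
      hausdorffEdist (closure {z : Y | ∃ h ∈ H, h x = z})
        (closure {z : Y | ∃ h ∈ H, h y = z}) ≤ edist x y) ∧
    (∀ A : Set (Set Y),
      A ⊆ Set.range (fun y : Y => closure {z : Y | ∃ h ∈ H, h y = z}) →
      (IsClosed ((fun y : Y => closure {z : Y | ∃ h ∈ H, h y = z}) ⁻¹' A) ↔
        ∀ y : Y,
          (∀ ε : ENNReal, 0 < ε → ∃ B ∈ A,
            hausdorffEdist (closure {z : Y | ∃ h ∈ H, h y = z}) B < ε) →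
          closure {z : Y | ∃ h ∈ H, h y = z} ∈ A)) := by
  refine ⟨hausdorffEDist_closure_orbit_le H, fun A hA => ⟨fun hcl y hy => ?_, fun hlim => ?_⟩⟩
  · refine hcl.closure_subset (Metric.mem_closure_iff_infEDist_zero.2 ?_)
    refine le_antisymm (le_of_forall_gt fun ε hε => ?_) zero_le
    obtain ⟨B, hBA, hB⟩ := hy ε hε
    obtain ⟨x, rfl⟩ := hA hBA
    replace hB : Metric.hausdorffEDist {z : Y | ∃ h ∈ H, h y = z} {z : Y | ∃ h ∈ H, h x = z} < ε :=
      Metric.hausdorffEDist_closure.symm.trans_lt hB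
    obtain ⟨_, ⟨h, hh, rfl⟩, hlt⟩ :=
      Metric.exists_edist_lt_of_hausdorffEDist_lt (x := y) (s := {z | ∃ h ∈ H, h y = z})
        ⟨1, H.one_mem, rfl⟩ hB
    refine Metric.infEDist_lt_iff.2 ⟨h x, ?_, hlt⟩
    rwa [Set.mem_preimage, setOf_orbit_apply H hh]
  · refine isClosed_of_closure_subset fun y hy => hlim y fun ε hε => ?_
    obtain ⟨x, hx, hlt⟩ := EMetric.mem_closure_iff.1 hy ε hε
    exact ⟨_, hx, (hausdorffEDist_closure_orbit_le H y x).trans_lt hlt⟩
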